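/- arXiv:2306.08144 — 4 statements merged into one kernel-verified Lean document; each statement's English description precedes it below -/
import Mathlib

section
/- Refinement exactly characterizes replacement for saturated target contracts: let C = (A, G) and C' = (A', G') be contracts over a set B of behaviors, with C' saturated (i.e., A'ᶜ ⊆ G'). Then C ⪯ C' if and only if every valid implementation of C is a valid implementation of C' and every valid environment of C' is a valid environment of C. -/
/-- Refinement exactly characterizes replacement for saturated target contracts. -/
theorem refinement_iff_replacement_saturated {B : Type*} (A G A' G' : Set B)
    (hsat : A'ᶜ ⊆ G') :
    (A' ⊆ A ∧ G ⊆ G') ↔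
      ((∀ M : Set B, M ∩ A ⊆ G → M ∩ A' ⊆ G') ∧
       (∀ E : Set B, E ⊆ A' → E ⊆ A)) := by
  constructor
  · rintro ⟨hA, hG⟩
    exact ⟨fun M hM x hx => hG (hM ⟨hx.1, hA hx.2⟩), fun E hE => hE.trans hA⟩
  · rintro ⟨hM, hE⟩
    refine ⟨hE A' subset_rfl, fun x hx => ?_⟩
    by_cases h : x ∈ A'
    · exact hM G Set.inter_subset_left ⟨hx, h⟩
    · exact hsat h
end

section
/- For saturated contracts, implementing the conjunction is equivalent to implementing both conjuncts: let C₁ = (A₁, G₁) and C₂ = (A₂, G₂) be saturated contracts over a set B of behaviors (A₁ᶜ ⊆ G₁ and A₂ᶜ ⊆ G₂). Then a component M ⊆ B is a valid implementation of C₁ ∧ C₂ = (A₁ ∪ A₂, G₁ ∩ G₂) if and only if M is a valid implementation of C₁ and a valid implementation of C₂. -/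
/-- For saturated contracts, implementing the conjunction is equivalent
to implementing both conjuncts. -/
theorem conjunction_impl_iff {B : Type*} (A₁ G₁ A₂ G₂ : Set B)
    (h₁ : A₁ᶜ ⊆ G₁) (h₂ : A₂ᶜ ⊆ G₂) (M : Set B) :
    M ∩ (A₁ ∪ A₂) ⊆ G₁ ∩ G₂ ↔ (M ∩ A₁ ⊆ G₁ ∧ M ∩ A₂ ⊆ G₂) := by
  constructor
  · intro h
    exact ⟨fun x hx => (h ⟨hx.1, Or.inl hx.2⟩).1, fun x hx => (h ⟨hx.1, Or.inr hx.2⟩).2⟩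
  · rintro ⟨k₁, k₂⟩ x ⟨hM, _⟩
    refine ⟨?_, ?_⟩
    · by_cases hx : x ∈ A₁
      · exact k₁ ⟨hM, hx⟩
      · exact h₁ hx
    · by_cases hx : x ∈ A₂
      · exact k₂ ⟨hM, hx⟩
      · exact h₂ hx
end

section
/- An environment of a composition together with an implementation of one component yields a valid environment for the other component: let C₁ = (A₁, G₁) and C₂ = (A₂, G₂) be saturated contracts over a set B of behaviors (A₁ᶜ ⊆ G₁ and A₂ᶜ ⊆ G₂). If E is a valid environment of the composition C₁ ∥ C₂ = ((A₁ ∩ A₂) ∪ (G₁ ∩ G₂)ᶜ, G₁ ∩ G₂) and M₂ is a valid implementation of C₂, then E ∩ M₂ ⊆ A₁, i.e., E ∩ M₂ is a valid environment of C₁. -/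
/-- An environment of a composition together with an implementation of one
component yields a valid environment for the other component. -/
theorem environment_of_composition {B : Type*} (A₁ G₁ A₂ G₂ : Set B)
    (h₁ : A₁ᶜ ⊆ G₁) (h₂ : A₂ᶜ ⊆ G₂) (E M₂ : Set B)
    (hE : E ⊆ (A₁ ∩ A₂) ∪ (G₁ ∩ G₂)ᶜ) (hM₂ : M₂ ∩ A₂ ⊆ G₂) :
    E ∩ M₂ ⊆ A₁ := by
  rintro x ⟨hxE, hxM⟩
  by_contra hx
  have hG₂ : x ∈ G₂ := by
    by_cases h : x ∈ A₂
    · exact hM₂ ⟨hxM, h⟩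
    · exact h₂ h
  rcases hE hxE with h | h
  · exact hx h.1
  · exact h ⟨h₁ hx, hG₂⟩
end

section
/- Contract composition is associative: for contracts C₁ = (A₁, G₁), C₂ = (A₂, G₂), and C₃ = (A₃, G₃) over a set B of behaviors, (C₁ ∥ C₂) ∥ C₃ = C₁ ∥ (C₂ ∥ C₃); in particular, both iterated compositions have guarantees G₁ ∩ G₂ ∩ G₃ and assumptions (A₁ ∩ A₂ ∩ A₃) ∪ (G₁ ∩ G₂ ∩ G₃)ᶜ. -/
/-- Composition of contracts. -/
def compose {B : Type*} (C₁ C₂ : Set B × Set B) : Set B × Set B :=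
  ((C₁.1 ∩ C₂.1) ∪ (C₁.2 ∩ C₂.2)ᶜ, C₁.2 ∩ C₂.2)

/-- Contract composition is associative, with the indicated closed form. -/
theorem compose_assoc {B : Type*} (A₁ G₁ A₂ G₂ A₃ G₃ : Set B) :
    compose (compose (A₁, G₁) (A₂, G₂)) (A₃, G₃)
      = compose (A₁, G₁) (compose (A₂, G₂) (A₃, G₃)) ∧
    (compose (compose (A₁, G₁) (A₂, G₂)) (A₃, G₃)).2 = G₁ ∩ G₂ ∩ G₃ ∧
    (compose (compose (A₁, G₁) (A₂, G₂)) (A₃, G₃)).1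
      = (A₁ ∩ A₂ ∩ A₃) ∪ (G₁ ∩ G₂ ∩ G₃)ᶜ := by
  refine ⟨Prod.ext ?_ ?_, rfl, ?_⟩
  · ext x
    simp only [compose, Set.mem_union, Set.mem_inter_iff, Set.mem_compl_iff]
    tauto
  · exact Set.inter_assoc _ _ _
  · ext x
    simp only [compose, Set.mem_union, Set.mem_inter_iff, Set.mem_compl_iff]
    tauto
end
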